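/- Let A = R[x; τ, δ] be a q-skew polynomial ring, q ≠ 1, with δ extending to a locally nilpotent iterative higher q-skew τ-derivation {d_i} on R. Define f: R → AS^{-1} (S = powers of x) by f(r) = Σ_{n=0}^∞ q^{n(n+1)/2}(q-1)^{-n} d_n τ^{-n}(r) x^{-n}. Then x f(r) = f(τ(r)) x for all r ∈ R. -/

import Mathlib

/-- The `q`-integer `(m)_q = q^(m-1) + ⋯ + q + 1`. -/
def qNat {k : Type*} [CommRing k] (q : k) (m : ℕ) : k := ∑ i ∈ Finset.range m, q ^ i

/-- The `q`-factorial `(m)!_q`. -/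
def qFact {k : Type*} [CommRing k] (q : k) : ℕ → k
  | 0 => 1
  | n + 1 => qNat q (n + 1) * qFact q n

/-- The `q`-binomial (Gaussian) coefficient `binom(n,m)_q`, defined via the
Pascal recursion `binom(n+1,m+1)_q = binom(n,m)_q + q^(m+1) binom(n,m+1)_q`. -/
def qBinom {k : Type*} [CommRing k] (q : k) : ℕ → ℕ → k
  | _, 0 => 1
  | 0, _ + 1 => 0
  | n + 1, m + 1 => qBinom q n m + q ^ (m + 1) * qBinom q n (m + 1)

theorem qBinom_eq_zero_of_lt {k : Type*} [CommRing k] (q : k) {n m : ℕ} (h : n < m) :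
    qBinom q n m = 0 := by
  induction n generalizing m with
  | zero =>
    obtain ⟨m, rfl⟩ := Nat.exists_eq_succ_of_ne_zero (Nat.ne_of_gt h)
    simp [qBinom]
  | succ n ih =>
    obtain ⟨m, rfl⟩ := Nat.exists_eq_succ_of_ne_zero (Nat.ne_zero_of_lt h)
    simp [qBinom, ih (show n < m by omega), ih (show n < m + 1 by omega)]

theorem qBinom_self {k : Type*} [CommRing k] (q : k) (n : ℕ) : qBinom q n n = 1 := by
  induction n with
  | zero => simp [qBinom]
  | succ n ih => simp [qBinom, ih, qBinom_eq_zero_of_lt q (Nat.lt_succ_self n)]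

theorem qBinom_succ_self {k : Type*} [CommRing k] (q : k) (n : ℕ) :
    qBinom q (n + 1) n = qNat q (n + 1) := by
  induction n with
  | zero => simp [qBinom, qNat]
  | succ n ih =>
    rw [qBinom, ih, qBinom_self, qNat, qNat, Finset.sum_range_succ _ (n + 1), mul_one]

theorem qNat_mul_sub_one {k : Type*} [CommRing k] (q : k) (n : ℕ) :
    qNat q n * (q - 1) = q ^ n - 1 :=
  geom_sum_mul q n

/-- A map that commutes with `τ` up to nonzero scalars vanishes on the `τ⁻¹`-orbit of any of
its zeros. -/
theorem map_iterate_symm_eq_zero {k R : Type*} [Field k] [Ring R] [Algebra k R]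
    {c : k} (hc : c ≠ 0) (τ : R ≃ₐ[k] R) (D : R →ₗ[k] R)
    (hD : ∀ r, D (τ r) = c • τ (D r)) {s : R} (hs : D s = 0) (m : ℕ) :
    D ((⇑τ.symm)^[m] s) = 0 := by
  induction m with
  | zero => exact hs
  | succ m ih =>
    rw [Function.iterate_succ_apply']
    have h := hD (τ.symm ((⇑τ.symm)^[m] s))
    rw [AlgEquiv.apply_symm_apply, ih, eq_comm, smul_eq_zero_iff_right hc] at h
    simpa using h

/-- With the derivation-removing map
`f(r) = Σ_{n≥0} q^{n(n+1)/2}(q-1)^{-n} d_n τ^{-n}(r) x^{-n}` in `AS⁻¹`, one has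
`x f(r) = f(τ(r)) x` for all `r ∈ R`. -/
theorem x_mul_f
    {k R B : Type*} [Field k] [Ring R] [Algebra k R] [Ring B] [Algebra k B]
    (q : k) (hq0 : q ≠ 0) (hq1 : q ≠ 1)
    (τ : R ≃ₐ[k] R) (δ : R →ₗ[k] R)
    (hder : ∀ r s : R, δ (r * s) = τ r * δ s + δ r * s)
    (hskew : ∀ r : R, δ (τ r) = q • τ (δ r))
    -- `{d_i}` is a locally nilpotent iterative higher q-skew τ-derivation extending δ:
    (d : ℕ → R →ₗ[k] R)
    (hd0 : d 0 = LinearMap.id) (hd1 : d 1 = δ)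
    (hprod : ∀ (n : ℕ) (r s : R), d n (r * s) =
        ∑ i ∈ Finset.range (n + 1), (⇑τ)^[n - i] (d i r) * d (n - i) s)
    (hdskew : ∀ (i : ℕ) (r : R), d i (τ r) = q ^ i • τ (d i r))
    (hiter : ∀ (i j : ℕ) (r : R), d i (d j r) = qBinom q (i + j) j • d (i + j) r)
    (hnil : ∀ r : R, ∃ N : ℕ, ∀ i ≥ N, d i r = 0)
    -- `B` plays the role of the localization `AS⁻¹` of `A = R[x; τ, δ]`,
    -- in which `x` is invertible and `x ι(r) = ι(τ r) x + ι(δ r)`: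
    (ι : R →ₐ[k] B) (x : B) (hx : IsUnit x)
    (hrel : ∀ r : R, x * ι r = ι (τ r) * x + ι (δ r))
    -- the derivation-removing map `f`:
    (f : R → B)
    (hf : ∀ r : R, f r = ∑ᶠ n : ℕ,
        (q ^ (n * (n + 1) / 2) * ((q - 1)⁻¹) ^ n) •
          (ι (d n ((⇑τ.symm)^[n] r)) * ((hx.unit⁻¹ : Bˣ) : B) ^ n))
    : ∀ r : R, x * f r = f (τ r) * x := by
  intro r
  set y : B := ((hx.unit⁻¹ : Bˣ) : B)
  have hxy : x * y = 1 := hx.mul_val_inv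
  have hyx : y * x = 1 := hx.val_inv_mul
  have hcomm (n : ℕ) : x * y ^ n = y ^ n * x :=
    Commute.pow_right (show x * y = y * x by rw [hxy, hyx]) n
  have hq1' : q - 1 ≠ 0 := sub_ne_zero.mpr hq1
  obtain ⟨N, hN⟩ := hnil r
  have hvanish (s : R) (hs : ∀ n ≥ N, d n s = 0) (n : ℕ) (hn : N ≤ n) :
      d n ((⇑τ.symm)^[n] s) = 0 :=
    map_iterate_symm_eq_zero (pow_ne_zero n hq0) τ (d n) (hdskew n) (hs n hn) n
  have hfsum (s : R) (hs : ∀ n ≥ N, d n s = 0) : f s = ∑ n ∈ Finset.range (N + 1),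
      (q ^ (n * (n + 1) / 2) * ((q - 1)⁻¹) ^ n) • (ι (d n ((⇑τ.symm)^[n] s)) * y ^ n) := by
    rw [hf]
    refine finsum_eq_sum_of_support_subset _ fun n hn => ?_
    by_contra hn'
    simp only [Finset.coe_range, Set.mem_Iio, not_lt] at hn'
    exact hn (by simp [hvanish s hs n (by omega)])
  have hτ (n : ℕ) : d n ((⇑τ.symm)^[n] (τ r)) = q ^ n • τ (d n ((⇑τ.symm)^[n] r)) := by
    rw [← hdskew]
    congr 1
    exact Function.Commute.iterate_left (fun a => by simp) n r
  have hδ (n : ℕ) : δ (d n ((⇑τ.symm)^[n] r)) =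
      (qNat q (n + 1) * q ^ (n + 1)) • τ (d (n + 1) ((⇑τ.symm)^[n + 1] r)) := by
    rw [← hd1, hiter, Nat.add_comm 1 n, qBinom_succ_self, mul_smul, ← hdskew,
      Function.iterate_succ_apply', AlgEquiv.apply_symm_apply]
  have hpartial (M : ℕ) :
      ∑ n ∈ Finset.range (M + 1), x * (q ^ (n * (n + 1) / 2) * ((q - 1)⁻¹) ^ n) •
          (ι (d n ((⇑τ.symm)^[n] r)) * y ^ n) =
        ∑ n ∈ Finset.range (M + 1), ((q ^ (n * (n + 1) / 2) * ((q - 1)⁻¹) ^ n) •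
          (ι (d n ((⇑τ.symm)^[n] (τ r))) * y ^ n)) * x +
        (q ^ (M * (M + 1) / 2) * ((q - 1)⁻¹) ^ M) •
          (ι (δ (d M ((⇑τ.symm)^[M] r))) * y ^ M) := by
    induction M with
    | zero => simp [hd0, hrel]
    | succ M ih =>
      have hexp : (M + 1) * (M + 1 + 1) / 2 = M * (M + 1) / 2 + (M + 1) := by
        rw [show (M + 1) * (M + 1 + 1) = M * (M + 1) + (M + 1) * 2 by ring,
          Nat.add_mul_div_right _ _ two_pos]
      have hy : x * y ^ (M + 1) = y ^ M := by
        rw [pow_succ', ← mul_assoc, hxy, one_mul]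
      have hstep : (q ^ (M * (M + 1) / 2) * ((q - 1)⁻¹) ^ M) •
            (ι (δ (d M ((⇑τ.symm)^[M] r))) * y ^ M) +
          (q ^ ((M + 1) * (M + 1 + 1) / 2) * ((q - 1)⁻¹) ^ (M + 1)) •
            (ι (τ (d (M + 1) ((⇑τ.symm)^[M + 1] r))) * x * y ^ (M + 1)) =
          ((q ^ ((M + 1) * (M + 1 + 1) / 2) * ((q - 1)⁻¹) ^ (M + 1)) •
            (ι (d (M + 1) ((⇑τ.symm)^[M + 1] (τ r))) * y ^ (M + 1))) * x := by
        rw [hδ M, hτ (M + 1), smul_mul_assoc, mul_assoc, mul_assoc, ← hcomm, hy, map_smul,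
          map_smul, smul_mul_assoc, smul_mul_assoc, smul_smul, smul_smul, ← add_smul, hexp]
        congr 1
        have hnat := qNat_mul_sub_one q (M + 1)
        have hinv : (q - 1)⁻¹ * (q - 1) = 1 := inv_mul_cancel₀ hq1'
        generalize (q - 1)⁻¹ = a at hinv ⊢
        generalize M * (M + 1) / 2 = e
        linear_combination q ^ e * a ^ M * q ^ (M + 1) *
          (a * hnat - qNat q (M + 1) * hinv)
      rw [Finset.sum_range_succ, ih, Finset.sum_range_succ _ (M + 1), mul_smul_comm,
        ← mul_assoc x, hrel, add_mul (ι _ * x), smul_add, ← hstep]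
      abel
  rw [hfsum r hN, hfsum (τ r) fun n hn => by rw [hdskew, hN n hn, map_zero, smul_zero],
    Finset.mul_sum, Finset.sum_mul, hpartial N, hvanish r hN N le_rfl]
  simp
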